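/- Let 0 < λ < μ and let ρ₁ ∈ (0,1) satisfy ρ₁ = e^{−μ(1−ρ₁)/λ}. Let T ~ Exp(μ(1−ρ₁)) and S ~ Exp(μ) be independent, and set Y = S + max(1/λ − T, 0). Then (E[Y²] + 2E[T·Y]) / (2E[Y]) = 1/(2λ) + 1/(μ(1−ρ₁)). -/

import Mathlib

open MeasureTheory ProbabilityTheory
open scoped ProbabilityTheory

lemma aud_integral_exp {r : ℝ} (hr : 0 < r) (g : ℝ → ℝ) :
    ∫ x, g x ∂(expMeasure r) = ∫ x in Set.Ioi (0:ℝ), (r * Real.exp (-(r * x))) * g x := by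
  have h : expMeasure r = volume.withDensity (exponentialPDF r) := rfl
  have hm : Measurable (exponentialPDF r) :=
    (measurable_exponentialPDFReal r).ennreal_ofReal
  rw [h, integral_withDensity_eq_integral_toReal_smul hm
    (Filter.Eventually.of_forall fun x => ENNReal.ofReal_lt_top),
    ← integral_Ici_eq_integral_Ioi, ← integral_indicator measurableSet_Ici]
  congr 1
  ext x
  by_cases hx : 0 ≤ x
  · rw [Set.indicator_of_mem (by exact hx), exponentialPDF_of_nonneg hx,
      ENNReal.toReal_ofReal (by positivity), smul_eq_mul]
  · rw [Set.indicator_of_notMem (by exact hx), exponentialPDF_of_neg (not_le.mp hx)]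
    simp

lemma aud_moment {r : ℝ} (hr : 0 < r) (n : ℕ) :
    ∫ x, x ^ n ∂(expMeasure r) = n.factorial / r ^ n := by
  rw [aud_integral_exp hr]
  have h := Real.integral_rpow_mul_exp_neg_mul_Ioi (a := n + 1) (r := r) (by positivity) hr
  have h2 : ∀ x : ℝ, r * Real.exp (-(r * x)) * x ^ n
      = r * (x ^ ((n:ℝ) + 1 - 1) * Real.exp (-(r * x))) := by
    intro x
    rw [add_sub_cancel_right, Real.rpow_natCast]; ring
  simp_rw [h2]
  rw [integral_const_mul, h, Real.Gamma_nat_eq_factorial]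
  have : (1 / r) ^ ((n:ℝ) + 1) = (1 / r) ^ (n + 1) := by
    rw [← Real.rpow_natCast]; push_cast; rfl
  rw [this, one_div, inv_pow]
  rw [pow_succ]
  field_simp

lemma aud_integrable {r : ℝ} (hr : 0 < r) (n : ℕ) :
    Integrable (fun x : ℝ => x ^ n) (expMeasure r) := by
  by_contra h
  have h1 := aud_moment hr n
  rw [integral_undef h] at h1
  have : (0:ℝ) < n.factorial / r ^ n := by positivity
  linarith

/-- Integral of a quadratic cut off beyond `a`. -/
lemma aud_cut {r a : ℝ} (hr : 0 < r) (ha : 0 < a) (g : ℝ → ℝ) (c0 c1 c2 : ℝ)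
    (hg : ∀ x, x ≤ a → g x = c0 + c1 * x + c2 * x ^ 2) (hg' : ∀ x, a < x → g x = 0) :
    ∫ x, g x ∂(expMeasure r) = (c0 + c1 / r + 2 * c2 / r ^ 2)
      - (c0 + c1 * a + c2 * a ^ 2 + (c1 + 2 * c2 * a) / r + 2 * c2 / r ^ 2)
        * Real.exp (-(r * a)) := by
  rw [aud_integral_exp hr]
  have h1 : ∫ x in Set.Ioi (0:ℝ), (r * Real.exp (-(r * x))) * g x
      = ∫ x in Set.Ioc (0:ℝ) a, (r * Real.exp (-(r * x))) * g x := by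
    apply setIntegral_eq_of_subset_of_forall_sdiff_eq_zero measurableSet_Ioi
      Set.Ioc_subset_Ioi_self
    intro x hx
    have : a < x := by
      by_contra h
      exact hx.2 ⟨hx.1, not_lt.mp h⟩
    rw [hg' x this, mul_zero]
  have h2 : ∫ x in Set.Ioc (0:ℝ) a, (r * Real.exp (-(r * x))) * g x
      = ∫ x in Set.Ioc (0:ℝ) a, (r * Real.exp (-(r * x))) * (c0 + c1 * x + c2 * x ^ 2) := by
    apply setIntegral_congr_fun measurableSet_Ioc
    intro x hx
    simp only [hg x hx.2]
  rw [h1, h2, ← intervalIntegral.integral_of_le ha.le]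
  rw [intervalIntegral.integral_eq_sub_of_hasDerivAt
    (f := fun x => -((c0 + c1 * x + c2 * x ^ 2 + (c1 + 2 * c2 * x) / r + 2 * c2 / r ^ 2)
        * Real.exp (-(r * x))))]
  · simp
    ring
  · intro x _
    have e : HasDerivAt (fun x => Real.exp (-(r * x))) (Real.exp (-(r * x)) * (-(r * 1))) x :=
      (((hasDerivAt_id x).const_mul r).neg).exp
    have p : HasDerivAt (fun x => c0 + c1 * x + c2 * x ^ 2 + (c1 + 2 * c2 * x) / r
        + 2 * c2 / r ^ 2) (c1 * 1 + c2 * (2 * x) + (2 * c2 * 1) / r) x := by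
      have q1 := ((hasDerivAt_id x).const_mul c1).const_add c0
      have q2 : HasDerivAt (fun x : ℝ => c2 * x ^ 2) (c2 * (2 * x)) x := by
        simpa using (hasDerivAt_pow 2 x).const_mul c2
      have q3 := (((hasDerivAt_id x).const_mul (2 * c2)).const_add c1).div_const r
      exact ((q1.add q2).add q3).add_const _
    convert! (p.mul e).neg using 1
    field_simp
    ring
  · apply Continuous.intervalIntegrable
    fun_prop

/-- Corollary 1: average age upon decisions of a D/M/1/M update-and-decide system.
With `T ~ Exp(μ(1-ρ₁))`, `S ~ Exp(μ)` independent and `Y = S + max (1/λ - T) 0`,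
`(E[Y²] + 2 E[T Y]) / (2 E[Y]) = 1/(2λ) + 1/(μ(1-ρ₁))`. -/
theorem average_AuD_DM1M
    {Ω : Type*} [MeasureSpace Ω] [IsProbabilityMeasure (ℙ : Measure Ω)]
    (lam μ ρ₁ : ℝ) (h0 : 0 < lam) (h1 : lam < μ)
    (hρ : ρ₁ ∈ Set.Ioo (0 : ℝ) 1) (hfix : ρ₁ = Real.exp (-μ * (1 - ρ₁) / lam))
    (T S : Ω → ℝ)
    (hTmeas : Measurable T) (hSmeas : Measurable S)
    (hTdist : Measure.map T ℙ = expMeasure (μ * (1 - ρ₁)))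
    (hSdist : Measure.map S ℙ = expMeasure μ)
    (hindep : IndepFun T S ℙ) :
    ((∫ ω, (S ω + max (1 / lam - T ω) 0) ^ 2 ∂ℙ)
        + 2 * ∫ ω, T ω * (S ω + max (1 / lam - T ω) 0) ∂ℙ)
      / (2 * ∫ ω, (S ω + max (1 / lam - T ω) 0) ∂ℙ)
      = 1 / (2 * lam) + 1 / (μ * (1 - ρ₁)) := by
  obtain ⟨hρ0, hρ1⟩ := hρ
  have hμ : 0 < μ := h0.trans h1
  set θ := μ * (1 - ρ₁) with hθd
  have hθ : 0 < θ := mul_pos hμ (by linarith)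
  set a := 1 / lam with had
  have ha : 0 < a := by positivity
  have hexp : Real.exp (-(θ * a)) = ρ₁ := by
    conv_rhs => rw [hfix]
    congr 1
    rw [hθd, had]; ring
  have hT2 : MemLp T 2 ℙ := by
    rw [memLp_two_iff_integrable_sq hTmeas.aestronglyMeasurable]
    have := aud_integrable hθ 2
    rw [← hTdist] at this
    exact this.comp_measurable hTmeas
  have hS2 : MemLp S 2 ℙ := by
    rw [memLp_two_iff_integrable_sq hSmeas.aestronglyMeasurable]
    have := aud_integrable hμ 2
    rw [← hSdist] at this
    exact this.comp_measurable hSmeas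
  set X : Ω → ℝ := fun ω => max (a - T ω) 0 with hXd
  have hXmeas : Measurable X := by fun_prop
  have hX2 : MemLp X 2 ℙ := by
    refine MemLp.of_le (g := fun ω => a - T ω) ((memLp_const a).sub hT2)
      hXmeas.aestronglyMeasurable (Filter.Eventually.of_forall fun ω => ?_)
    rw [Real.norm_eq_abs, Real.norm_eq_abs, abs_of_nonneg (le_max_right _ _)]
    exact max_le (le_abs_self _) (abs_nonneg _)
  have tr : ∀ g : ℝ → ℝ, Measurable g → ∫ ω, g (T ω) ∂ℙ = ∫ x, g x ∂(expMeasure θ) := by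
    intro g hg
    rw [← hTdist, integral_map hTmeas.aemeasurable hg.aestronglyMeasurable]
  have trS : ∀ g : ℝ → ℝ, Measurable g → ∫ ω, g (S ω) ∂ℙ = ∫ x, g x ∂(expMeasure μ) := by
    intro g hg
    rw [← hSdist, integral_map hSmeas.aemeasurable hg.aestronglyMeasurable]
  have ES : ∫ ω, S ω ∂ℙ = 1 / μ := by
    have := trS (fun x => x ^ 1) (by fun_prop)
    rw [aud_moment hμ] at this
    simpa using this
  have ESS : ∫ ω, S ω ^ 2 ∂ℙ = 2 / μ ^ 2 := by
    have := trS (fun x => x ^ 2) (by fun_prop)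
    rw [aud_moment hμ] at this
    simpa using this
  have ET : ∫ ω, T ω ∂ℙ = 1 / θ := by
    have := tr (fun x => x ^ 1) (by fun_prop)
    rw [aud_moment hθ] at this
    simpa using this
  have EX := tr (fun x => max (a - x) 0) (by fun_prop)
  rw [aud_cut hθ ha _ a (-1) 0
    (fun x hx => by rw [max_eq_left (by linarith)]; ring)
    (fun x hx => by rw [max_eq_right (by linarith)]), hexp] at EX
  have EXX := tr (fun x => (max (a - x) 0) ^ 2) (by fun_prop)
  rw [aud_cut hθ ha _ (a ^ 2) (-2 * a) 1
    (fun x hx => by rw [max_eq_left (by linarith)]; ring)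
    (fun x hx => by rw [max_eq_right (by linarith)]; ring), hexp] at EXX
  have ETX := tr (fun x => x * max (a - x) 0) (by fun_prop)
  rw [aud_cut hθ ha _ 0 a (-1)
    (fun x hx => by rw [max_eq_left (by linarith)]; ring)
    (fun x hx => by rw [max_eq_right (by linarith)]; ring), hexp] at ETX
  change ∫ ω, X ω ∂ℙ = _ at EX
  change ∫ ω, X ω ^ 2 ∂ℙ = _ at EXX
  change ∫ ω, T ω * X ω ∂ℙ = _ at ETX
  have hiXS : IndepFun X S ℙ :=
    hindep.comp (φ := fun x => max (a - x) 0) (ψ := id) (by fun_prop) measurable_id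
  have EXS : ∫ ω, X ω * S ω ∂ℙ = (∫ ω, X ω ∂ℙ) * ∫ ω, S ω ∂ℙ :=
    hiXS.integral_fun_mul_eq_mul_integral hXmeas.aestronglyMeasurable
      hSmeas.aestronglyMeasurable
  have ETS : ∫ ω, T ω * S ω ∂ℙ = (∫ ω, T ω ∂ℙ) * ∫ ω, S ω ∂ℙ :=
    hindep.integral_fun_mul_eq_mul_integral hTmeas.aestronglyMeasurable
      hSmeas.aestronglyMeasurable
  have iXS : Integrable (fun ω => X ω * S ω) ℙ := hX2.integrable_mul hS2
  have iTS : Integrable (fun ω => T ω * S ω) ℙ := hT2.integrable_mul hS2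
  have iTX : Integrable (fun ω => T ω * X ω) ℙ := hT2.integrable_mul hX2
  have EY : ∫ ω, (S ω + X ω) ∂ℙ = (∫ ω, S ω ∂ℙ) + ∫ ω, X ω ∂ℙ :=
    integral_add (hS2.integrable (by norm_num)) (hX2.integrable (by norm_num))
  have ETY : ∫ ω, T ω * (S ω + X ω) ∂ℙ = (∫ ω, T ω * S ω ∂ℙ) + ∫ ω, T ω * X ω ∂ℙ := by
    simp_rw [mul_add]
    exact integral_add iTS iTX
  have EYY : ∫ ω, (S ω + X ω) ^ 2 ∂ℙ
      = (∫ ω, S ω ^ 2 ∂ℙ) + 2 * (∫ ω, X ω * S ω ∂ℙ) + ∫ ω, X ω ^ 2 ∂ℙ := by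
    have : ∀ ω, (S ω + X ω) ^ 2 = S ω ^ 2 + 2 * (X ω * S ω) + X ω ^ 2 := fun ω => by ring
    simp_rw [this]
    have i1 : Integrable (fun ω => S ω ^ 2 + 2 * (X ω * S ω)) ℙ :=
      hS2.integrable_sq.add (iXS.const_mul 2)
    rw [integral_add i1 hX2.integrable_sq,
      integral_add hS2.integrable_sq (iXS.const_mul 2), integral_const_mul]
  change ((∫ ω, (S ω + X ω) ^ 2 ∂ℙ) + 2 * ∫ ω, T ω * (S ω + X ω) ∂ℙ)
      / (2 * ∫ ω, (S ω + X ω) ∂ℙ) = _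
  have hlam : 1 / (2 * lam) = a / 2 := by rw [had]; field_simp
  have hρe : ρ₁ = 1 - θ / μ := by rw [hθd]; field_simp; ring
  have EX' : ∫ ω, X ω ∂ℙ = a - 1 / μ := by
    rw [EX, hρe]; field_simp; ring
  rw [EYY, ETY, EY, EXS, ETS, EX', EXX, ETX, ES, ESS, ET, hlam, hρe]
  have : 1 / μ + (a - 1 / μ) = a := by ring
  rw [this]
  clear_value θ a
  field_simp
  ring
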